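/- Let D be the unique derivation on the field ℂ(t) of rational functions extending the formal derivative of polynomials, and let L₄(f) := D⁵f − 20·t·D³f − 30·D²f + 64·t²·Df + 64·t·f for f ∈ ℂ(t). Let a ∈ ℂ and d ≥ 1, and suppose f ∈ ℂ(t) has a pole of order exactly d at a, i.e. f = g/(t−a)^d where g ∈ ℂ(t) has neither a zero nor a pole at a. Then L₄(f) has a pole of order exactly d + 5 at a, i.e. L₄(f) = h/(t−a)^{d+5} with h ∈ ℂ(t) having neither a zero nor a pole at a. -/

import Mathlib

open Polynomial in
/-- `r` is regular at `a`, with value `c` there. -/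
def RatFunc.HasValueAt (a : ℂ) (r : RatFunc ℂ) (c : ℂ) : Prop :=
  ∃ p q : ℂ[X], q.eval a ≠ 0 ∧ p.eval a = c * q.eval a ∧
    r * algebraMap ℂ[X] (RatFunc ℂ) q = algebraMap ℂ[X] (RatFunc ℂ) p

/-- `(t - a) ^ n * f` is regular at `a`, with value `c` there. -/
def RatFunc.HasPolarCoeffAt (a : ℂ) (n : ℕ) (f : RatFunc ℂ) (c : ℂ) : Prop :=
  ∃ g : RatFunc ℂ, g.HasValueAt a c ∧ f = g / (RatFunc.X - RatFunc.C a) ^ n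

namespace RatFunc

open Polynomial

variable {a c e : ℂ} {n : ℕ} {r s f g : RatFunc ℂ}

lemma algebraMap_X_sub_C (a : ℂ) :
    algebraMap ℂ[X] (RatFunc ℂ) (Polynomial.X - Polynomial.C a) = RatFunc.X - RatFunc.C a := by
  rw [map_sub, algebraMap_X, algebraMap_C]

lemma X_sub_C_ne_zero (a : ℂ) : (RatFunc.X - RatFunc.C a : RatFunc ℂ) ≠ 0 := by
  rw [← algebraMap_X_sub_C]
  exact RatFunc.algebraMap_ne_zero (Polynomial.X_sub_C_ne_zero a)

lemma algebraMap_ne_zero_of_eval_ne_zero {q : ℂ[X]} (hq : q.eval a ≠ 0) :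
    algebraMap ℂ[X] (RatFunc ℂ) q ≠ 0 := by
  refine RatFunc.algebraMap_ne_zero ?_
  rintro rfl
  simp at hq

lemma hasValueAt_algebraMap (a : ℂ) (p : ℂ[X]) :
    (algebraMap ℂ[X] (RatFunc ℂ) p).HasValueAt a (p.eval a) :=
  ⟨p, 1, by simp, by simp, by simp⟩

lemma hasValueAt_of_eval_denom_ne_zero (h : (denom g).eval a ≠ 0) :
    g.HasValueAt a ((num g).eval a / (denom g).eval a) := by
  refine ⟨num g, denom g, h, by field_simp, ?_⟩
  exact (div_eq_iff (algebraMap_ne_zero_of_eval_ne_zero h)).mp (num_div_denom g) |>.symm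

lemma HasValueAt.add (hr : r.HasValueAt a c) (hs : s.HasValueAt a e) :
    (r + s).HasValueAt a (c + e) := by
  obtain ⟨p, q, hq, hp, h⟩ := hr
  obtain ⟨p', q', hq', hp', h'⟩ := hs
  refine ⟨p * q' + p' * q, q * q', by simp [hq, hq'], by simp [hp, hp']; ring, ?_⟩
  simp only [map_add, map_mul, ← h, ← h']
  ring

lemma HasValueAt.mul (hr : r.HasValueAt a c) (hs : s.HasValueAt a e) :
    (r * s).HasValueAt a (c * e) := by
  obtain ⟨p, q, hq, hp, h⟩ := hr
  obtain ⟨p', q', hq', hp', h'⟩ := hs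
  refine ⟨p * p', q * q', by simp [hq, hq'], by simp [hp, hp']; ring, ?_⟩
  simp only [map_mul, ← h, ← h']
  ring

lemma hasValueAt_X_sub_C (a : ℂ) : (RatFunc.X - RatFunc.C a : RatFunc ℂ).HasValueAt a 0 := by
  have h := hasValueAt_algebraMap a (Polynomial.X - Polynomial.C a)
  rwa [algebraMap_X_sub_C, Polynomial.eval_sub, Polynomial.eval_X, Polynomial.eval_C,
    sub_self] at h

lemma HasValueAt.eval_num_ne_zero_and_eval_denom_ne_zero (hr : r.HasValueAt a c) (hc : c ≠ 0) :
    (num r).eval a ≠ 0 ∧ (denom r).eval a ≠ 0 := by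
  obtain ⟨p, q, hq, hp, h⟩ := hr
  have key : num r * q = p * denom r := by
    apply algebraMap_injective ℂ
    have hd := RatFunc.algebraMap_ne_zero (denom_ne_zero r)
    rw [map_mul, map_mul, ← h]
    linear_combination
      algebraMap ℂ[X] (RatFunc ℂ) q * (div_eq_iff hd).mp (num_div_denom r)
  have hev := congrArg (Polynomial.eval a) key
  obtain ⟨u, v, huv⟩ := isCoprime_num_denom r
  have hev' := congrArg (Polynomial.eval a) huv
  simp only [Polynomial.eval_mul, Polynomial.eval_add, Polynomial.eval_one, hp] at hev hev'
  grind

lemma HasValueAt.derivation {D : Derivation ℂ (RatFunc ℂ) (RatFunc ℂ)}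
    (hD : ∀ p : ℂ[X], D (algebraMap ℂ[X] (RatFunc ℂ) p) =
      algebraMap ℂ[X] (RatFunc ℂ) (derivative p))
    (hr : r.HasValueAt a c) : ∃ e, (D r).HasValueAt a e := by
  obtain ⟨p, q, hq, hp, h⟩ := hr
  refine ⟨(derivative p * q - p * derivative q).eval a / (q ^ 2).eval a,
    derivative p * q - p * derivative q, q ^ 2, by simp [hq], ?_, ?_⟩
  · rw [div_mul_cancel₀]
    simp [hq]
  · have h' := congrArg D h
    rw [D.leibniz, hD, hD, smul_eq_mul, smul_eq_mul] at h'
    simp only [map_sub, map_mul, map_pow, ← h, ← h']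
    ring

lemma HasPolarCoeffAt.add (hf : f.HasPolarCoeffAt a n c) (hg : g.HasPolarCoeffAt a n e) :
    (f + g).HasPolarCoeffAt a n (c + e) := by
  obtain ⟨r, hr, rfl⟩ := hf
  obtain ⟨s, hs, rfl⟩ := hg
  exact ⟨r + s, hr.add hs, (add_div _ _ _).symm⟩

lemma HasPolarCoeffAt.algebraMap_mul (hf : f.HasPolarCoeffAt a n c) (p : ℂ[X]) :
    (algebraMap ℂ[X] (RatFunc ℂ) p * f).HasPolarCoeffAt a n (p.eval a * c) := by
  obtain ⟨r, hr, rfl⟩ := hf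
  exact ⟨_, (hasValueAt_algebraMap a p).mul hr, (mul_div_assoc _ _ _).symm⟩

lemma HasPolarCoeffAt.succ (hf : f.HasPolarCoeffAt a n c) :
    f.HasPolarCoeffAt a (n + 1) 0 := by
  obtain ⟨r, hr, rfl⟩ := hf
  have := X_sub_C_ne_zero a
  refine ⟨(RatFunc.X - RatFunc.C a) * r, by simpa using (hasValueAt_X_sub_C a).mul hr, ?_⟩
  rw [pow_succ]
  field_simp

lemma HasPolarCoeffAt.of_lt (hf : f.HasPolarCoeffAt a n c) {m : ℕ} (h : n < m) :
    f.HasPolarCoeffAt a m 0 := by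
  induction m, h using Nat.le_induction with
  | base => exact hf.succ
  | succ m _ ih => exact ih.succ

lemma HasPolarCoeffAt.derivation {D : Derivation ℂ (RatFunc ℂ) (RatFunc ℂ)}
    (hD : ∀ p : ℂ[X], D (algebraMap ℂ[X] (RatFunc ℂ) p) =
      algebraMap ℂ[X] (RatFunc ℂ) (derivative p))
    (hf : f.HasPolarCoeffAt a n c) : (D f).HasPolarCoeffAt a (n + 1) (-n * c) := by
  obtain ⟨r, hr, rfl⟩ := hf
  obtain ⟨e, he⟩ := hr.derivation hD
  have h0 := X_sub_C_ne_zero a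
  have hDX : D (RatFunc.X - RatFunc.C a) = 1 := by
    rw [← algebraMap_X_sub_C, hD, Polynomial.derivative_X_sub_C, map_one]
  refine ⟨(RatFunc.X - RatFunc.C a) * D r + algebraMap ℂ[X] (RatFunc ℂ) (-n) * r, ?_, ?_⟩
  · simpa using ((hasValueAt_X_sub_C a).mul he).add ((hasValueAt_algebraMap a (-n)).mul hr)
  · have hpow : D ((RatFunc.X - RatFunc.C a) ^ n) * (RatFunc.X - RatFunc.C a) =
        (n : RatFunc ℂ) * (RatFunc.X - RatFunc.C a) ^ n := by
      rw [D.leibniz_pow, hDX]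
      rcases n with _ | n
      · simp
      · simp only [smul_eq_mul, nsmul_eq_mul, Nat.add_sub_cancel, Nat.cast_add, Nat.cast_one]
        ring
    have hmul := D.leibniz (r / (RatFunc.X - RatFunc.C a) ^ n) ((RatFunc.X - RatFunc.C a) ^ n)
    rw [div_mul_cancel₀ _ (pow_ne_zero n h0), smul_eq_mul, smul_eq_mul] at hmul
    rw [eq_div_iff (pow_ne_zero _ h0), hmul, map_neg, map_natCast]
    field_simp
    linear_combination (-r) * hpow

end RatFunc


/-- If `f ∈ ℂ(t)` has a pole of order exactly `d ≥ 1` at `a` (i.e. `f = g/(t−a)^d` with `g`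
having neither a zero nor a pole at `a`), then `L₄(f) = D⁵f − 20tD³f − 30D²f + 64t²Df + 64tf`
has a pole of order exactly `d + 5` at `a`, where `D` is the unique derivation of `ℂ(t)`
extending the formal derivative of polynomials. -/
theorem stmt_8 (D : Derivation ℂ (RatFunc ℂ) (RatFunc ℂ))
    (hD : ∀ p : Polynomial ℂ,
      D (algebraMap (Polynomial ℂ) (RatFunc ℂ) p) =
        algebraMap (Polynomial ℂ) (RatFunc ℂ) (Polynomial.derivative p))
    (a : ℂ) (d : ℕ) (hd : 1 ≤ d) (f g : RatFunc ℂ)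
    (hgnum : Polynomial.eval a (RatFunc.num g) ≠ 0)
    (hgden : Polynomial.eval a (RatFunc.denom g) ≠ 0)
    (hf : f = g / (RatFunc.X - RatFunc.C a) ^ d) :
    ∃ h : RatFunc ℂ,
      Polynomial.eval a (RatFunc.num h) ≠ 0 ∧
      Polynomial.eval a (RatFunc.denom h) ≠ 0 ∧
      D (D (D (D (D f)))) - 20 * RatFunc.X * D (D (D f)) - 30 * D (D f)
          + 64 * RatFunc.X ^ 2 * D f + 64 * RatFunc.X * f
        = h / (RatFunc.X - RatFunc.C a) ^ (d + 5) := by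
  have hpole : f.HasPolarCoeffAt a d (g.num.eval a / g.denom.eval a) :=
    ⟨g, RatFunc.hasValueAt_of_eval_denom_ne_zero hgden, hf⟩
  have h1 := hpole.derivation hD
  have h2 := h1.derivation hD
  have h3 := h2.derivation hD
  have h5 := (h3.derivation hD).derivation hD
  obtain ⟨h, hval, heq⟩ := (((h5.add
    ((h3.algebraMap_mul (-20 * Polynomial.X)).of_lt (by omega : d + 3 < d + 5))).add
    ((h2.algebraMap_mul (-30)).of_lt (by omega : d + 2 < d + 5))).add
    ((h1.algebraMap_mul (64 * Polynomial.X ^ 2)).of_lt (by omega : d + 1 < d + 5))).add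
    ((hpole.algebraMap_mul (64 * Polynomial.X)).of_lt (by omega : d < d + 5))
  have hne : ∀ k : ℕ, -((d + k : ℕ) : ℂ) ≠ 0 := fun k ↦
    neg_ne_zero.mpr (Nat.cast_ne_zero.mpr (by omega))
  have hc := hval.eval_num_ne_zero_and_eval_denom_ne_zero (by
    simp only [add_zero]
    exact mul_ne_zero (hne 4) (mul_ne_zero (hne 3) (mul_ne_zero (hne 2)
      (mul_ne_zero (hne 1) (mul_ne_zero (hne 0) (div_ne_zero hgnum hgden))))))
  refine ⟨h, hc.1, hc.2, ?_⟩
  rw [← heq]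
  simp only [map_mul, map_neg, map_pow, map_ofNat, RatFunc.algebraMap_X]
  ring
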